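/- Fix an integer r ≥ 1 and let s, B, b_0,…,b_{2r+1}, g_k, w_k be as defined. Then for every integer k with 0 ≤ k ≤ r, one has g_k − s_k·g_{k+1} = (s_k − 1)·(b_{k+1} · b_{k+2} · ⋯ · b_{2r−k}) · w_{k+1}, where the product b_{k+1}⋯b_{2r−k} is over all indices j with k+1 ≤ j ≤ 2r−k (and equals 1 when k = r). -/

import Mathlib

/-- Sylvester's sequence: `s 0 = 2`, `s (j+1) = s j * (s j − 1) + 1`;
it begins 2, 3, 7, 43, 1807, …. -/
def sylv : ℕ → ℕ
  | 0 => 2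
  | n + 1 => sylv n * (sylv n - 1) + 1

/-- The alternating sum `B(x₁,…,x_k) = ∑_{j=0}^{k} (−1)^{k−j} x₁⋯x_j`
(the empty product being 1), characterized by `B [] = 1` and
`B (x :: xs) = x * B xs + (−1)^(length (x :: xs))`. -/
def Bsum : List ℤ → ℤ
  | [] => 1
  | x :: xs => x * Bsum xs + (-1) ^ (xs.length + 1)

/-- `Zl r t` is the list of length `2t` formed by concatenating the pairs
`(b_{r+u}, b_{r+1−u})` for `u = 1, …, t`, where `b` are the exponents
defined inductively together with this list. -/
def Zl (r : ℕ) : ℕ → List ℤ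
  | 0 => []
  | t + 1 => Zl r t ++ [1 + ((sylv (r - t) : ℤ) - 1) ^ 2 * Bsum (Zl r t), (sylv (r - t) : ℤ)]

/-- The exponents `b_0, …, b_{2r+1}`: `b_j = s_j` for `j ≤ r`, and
`b_{r+i} = 1 + (b_{r+1−i} − 1)² · B(Z_{i−1})` for `1 ≤ i ≤ r+1`
(here, for `j = r + i`, one has `b_{r+1−i} = s_{2r+1−j}`). -/
def bexp (r j : ℕ) : ℤ :=
  if j ≤ r then (sylv j : ℤ)
  else 1 + ((sylv (2 * r + 1 - j) : ℤ) - 1) ^ 2 * Bsum (Zl r (j - r - 1))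

/-- The list `L_k = (b_{r+1}, b_r, b_{r+2}, b_{r−1}, …, b_{2r+1−k}, b_k)`,
formed by concatenating the pairs `(b_{r+t}, b_{r+1−t})` for `t = 1, …, r+1−k`. -/
def Lk (r k : ℕ) : List ℤ := Zl r (r + 1 - k)

/-- `t_k := B(L_k)`. -/
def tB (r k : ℕ) : ℤ := Bsum (Lk r k)

/-- `g_k := B(reverse of L_k)`. -/
def gB (r k : ℕ) : ℤ := Bsum (Lk r k).reverse

/-- `T_k`: the alternating sum of `B` over the suffixes of `L_k`
(the full list with sign `+`, the empty suffix contributing `+1`). -/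
def TB (r k : ℕ) : ℤ :=
  ∑ m ∈ Finset.range ((Lk r k).length + 1), (-1) ^ m * Bsum ((Lk r k).drop m)

/-- `w_k := (s_k − 1)·T_k − 1`. -/
def wB (r k : ℕ) : ℤ := ((sylv k : ℤ) - 1) * TB r k - 1

/-- The alternating sum of `Bsum` over the suffixes of a list. -/
def suffixBsum (L : List ℤ) : ℤ :=
  ∑ m ∈ Finset.range (L.length + 1), (-1) ^ m * Bsum (L.drop m)

theorem suffixBsum_nil : suffixBsum [] = 1 := by
  simp [suffixBsum, Bsum]

theorem suffixBsum_cons (x : ℤ) (L : List ℤ) :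
    suffixBsum (x :: L) = Bsum (x :: L) - suffixBsum L := by
  rw [suffixBsum, List.length_cons, Finset.sum_range_succ', suffixBsum, sub_eq_neg_add,
    ← Finset.sum_neg_distrib]
  congr 1
  · refine Finset.sum_congr rfl fun m _ => ?_
    rw [List.drop_succ_cons, pow_succ]
    ring
  · simp

theorem Bsum_append_singleton (L : List ℤ) (z : ℤ) :
    Bsum (L ++ [z]) = L.prod * z - Bsum L := by
  induction L with
  | nil => simp [Bsum]; ring
  | cons x L ih =>
    simp only [List.cons_append, Bsum, ih, List.prod_cons, List.length_append,
      List.length_singleton]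
    ring

theorem Bsum_reverse_append_singleton (L : List ℤ) (z : ℤ) :
    Bsum (L ++ [z]).reverse = z * Bsum L.reverse + (-1) ^ (L.length + 1) := by
  simp [Bsum]

theorem Bsum_reverse_cons (x : ℤ) (L : List ℤ) :
    Bsum (x :: L).reverse = L.prod * x - Bsum L.reverse := by
  rw [List.reverse_cons, Bsum_append_singleton, List.prod_reverse]

theorem suffixBsum_append_singleton (L : List ℤ) (z : ℤ) :
    suffixBsum (L ++ [z]) =
      z * Bsum L.reverse - (-1) ^ L.length - suffixBsum L := by
  induction L with
  | nil => simp [suffixBsum_cons, suffixBsum_nil, Bsum]; ring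
  | cons x L ih =>
    rw [List.cons_append, suffixBsum_cons, ih, suffixBsum_cons, Bsum_reverse_cons,
      ← List.cons_append, Bsum_append_singleton, List.prod_cons, List.length_cons]
    ring

theorem one_le_sylv (n : ℕ) : 1 ≤ sylv n := by
  cases n <;> simp [sylv]

theorem sylv_succ_cast (n : ℕ) :
    (sylv (n + 1) : ℤ) = (sylv n : ℤ) * ((sylv n : ℤ) - 1) + 1 := by
  rw [sylv]
  push_cast [one_le_sylv n]
  rfl

theorem Zl_length (r t : ℕ) : (Zl r t).length = 2 * t := by
  induction t with
  | zero => rfl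
  | succ t ih => simp [Zl, ih]; ring

theorem Zl_prod (r t : ℕ) (ht : t ≤ r) :
    (Zl r t).prod = ∏ j ∈ Finset.Icc (r + 1 - t) (r + t), bexp r j := by
  induction t with
  | zero => simp [Zl]
  | succ t ih =>
    have hlow : bexp r (r - t) = (sylv (r - t) : ℤ) := if_pos (Nat.sub_le r t)
    have hhigh : bexp r (r + t + 1) =
        1 + ((sylv (r - t) : ℤ) - 1) ^ 2 * Bsum (Zl r t) := by
      rw [bexp, if_neg (by omega), show 2 * r + 1 - (r + t + 1) = r - t by omega,
        show r + t + 1 - r - 1 = t by omega]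
    rw [show r + 1 - (t + 1) = r - t by omega, ← add_assoc,
      Finset.prod_Icc_succ_top (by omega), ← Finset.mul_prod_Ioc_eq_prod_Icc (by omega),
      ← Finset.Icc_add_one_left_eq_Ioc, show r - t + 1 = r + 1 - t by omega,
      ← ih (by omega), hlow, hhigh, Zl]
    simp only [List.prod_append, List.prod_cons, List.prod_nil]
    ring

theorem Zl_defect (r t : ℕ) (ht : t ≤ r) :
    ((sylv (r + 1 - t) : ℤ) - 1) *
        (Bsum (Zl r t) * Bsum (Zl r t).reverse - (Zl r t).prod * suffixBsum (Zl r t)) =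
      1 - (Zl r t).prod := by
  induction t with
  | zero => simp [Zl, Bsum, suffixBsum_nil]
  | succ t ih =>
    have ih := ih (by omega)
    rw [show r + 1 - t = (r - t) + 1 by omega, sylv_succ_cast] at ih
    have hlen : (-1 : ℤ) ^ (Zl r t).length = 1 := by simp [Zl_length]
    rw [show r + 1 - (t + 1) = r - t by omega, Zl, List.append_cons]
    simp only [Bsum_append_singleton, Bsum_reverse_append_singleton,
      suffixBsum_append_singleton, List.prod_append, List.prod_singleton,
      List.length_append, List.length_singleton, pow_succ, hlen]
    linear_combination (1 + ((sylv (r - t) : ℤ) - 1) ^ 2 * Bsum (Zl r t)) * ih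

/-- Lemma 4.3 of Esser–Totaro: for `0 ≤ k ≤ r`,
`g_k − s_k·g_{k+1} = (s_k − 1) · b_{k+1} ⋯ b_{2r−k} · w_{k+1}`. -/
theorem g_recursion (r : ℕ) (hr : 1 ≤ r) (k : ℕ) (hk : k ≤ r) :
    gB r k - (sylv k : ℤ) * gB r (k + 1) =
      ((sylv k : ℤ) - 1) * (∏ j ∈ Finset.Icc (k + 1) (2 * r - k), bexp r j) * wB r (k + 1) := by
  have hdefect := Zl_defect r (r - k) (by omega)
  have hprod := Zl_prod r (r - k) (by omega)
  have hlen : (-1 : ℤ) ^ (Zl r (r - k)).length = 1 := by simp [Zl_length]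
  rw [show r + 1 - (r - k) = k + 1 by omega] at hdefect hprod
  rw [show r + (r - k) = 2 * r - k by omega] at hprod
  have hT : TB r (k + 1) = suffixBsum (Zl r (r - k)) := by
    rw [TB, Lk, show r + 1 - (k + 1) = r - k by omega, suffixBsum]
  rw [← hprod, wB, hT, gB, gB, Lk, Lk, show r + 1 - (k + 1) = r - k by omega,
    show r + 1 - k = (r - k) + 1 by omega, Zl, show r - (r - k) = k by omega,
    List.append_cons]
  rw [sylv_succ_cast] at hdefect ⊢
  simp only [Bsum_reverse_append_singleton, List.length_append, List.length_singleton,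
    pow_succ, hlen]
  linear_combination ((sylv k : ℤ) - 1) * hdefect
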